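/- arXiv:1708.07217 — 8 statements merged into one kernel-verified Lean document; each statement's English description precedes it below -/
import Mathlib

section
/- Let n ≥ 3 and let C = (c_{ij}) be a real cost matrix for the traveling salesman problem on the complete directed graph on vertices {1,…,n}. Then C satisfies the constant value property (all tours have the same cost) if and only if C is a weak sum matrix, i.e., there exist vectors a, b ∈ ℝⁿ with c_{ij} = a_i + b_j for all i, j ∈ {1,…,n} with i ≠ j. Moreover, in this case the common cost of every tour equals Σ_{i=1}^{n} (a_i + b_i). -/
open Finset

/-- A tour (Hamiltonian cycle) on the complete directed graph on `Fin n`,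
identified with a cyclic permutation whose unique cycle has length `n`. -/
def IsTour {n : ℕ} (σ : Equiv.Perm (Fin n)) : Prop :=
  σ.IsCycle ∧ σ.support = Finset.univ

/-- The cost of a tour `σ` with respect to a linear cost matrix `C`. -/
def linCost {n : ℕ} (C : Fin n → Fin n → ℝ) (σ : Equiv.Perm (Fin n)) : ℝ :=
  ∑ i, C i (σ i)

/-- The quadratic cost of a tour `σ` with respect to a quadratic cost matrix `Q`. -/
def quadCost {n : ℕ} (Q : Fin n × Fin n → Fin n × Fin n → ℝ) (σ : Equiv.Perm (Fin n)) : ℝ :=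
  ∑ i, ∑ j, Q (i, σ i) (j, σ j)

/-- `Q` is linearizable if some linear cost matrix `C` satisfies `Q[τ] = C(τ)` for all tours. -/
def Linearizable {n : ℕ} (Q : Fin n × Fin n → Fin n × Fin n → ℝ) : Prop :=
  ∃ C : Fin n → Fin n → ℝ, ∀ σ : Equiv.Perm (Fin n), IsTour σ → quadCost Q σ = linCost C σ

/-- Inserting a fixed point `v` into a cycle, right before `x`, gives a cycle. -/
theorem Equiv.Perm.IsCycle.swap_mul_of_apply_eq {α : Type*} [Fintype α] [DecidableEq α]
    {ρ : Equiv.Perm α} (hρ : ρ.IsCycle) {v x : α} (hv : ρ v = v) (hx : ρ x ≠ x) :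
    (Equiv.swap v x * ρ).IsCycle := by
  have hne : ρ.toList x ≠ [] := by simpa using hx
  obtain ⟨y, l, hl⟩ := List.exists_cons_of_ne_nil hne
  have hyx : y = x := by
    have h0 := Equiv.Perm.toList_getElem_zero (p := ρ) (x := x) (by simpa using hx)
    simpa [hl] using h0
  subst hyx
  have hform : (y :: l).formPerm = ρ := by
    rw [← hl, Equiv.Perm.formPerm_toList, hρ.cycleOf_eq hx]
  have hnodup : (v :: y :: l).Nodup := by
    rw [List.nodup_cons, ← hl]
    refine ⟨fun hmem => ?_, Equiv.Perm.nodup_toList ρ y⟩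
    obtain ⟨hs, -⟩ := Equiv.Perm.mem_toList_iff.1 hmem
    exact hx (hs.apply_eq_self_iff.2 hv)
  have := List.isCycle_formPerm hnodup (by simp)
  rwa [List.formPerm_cons_cons, hform] at this

theorem isTour_mul_swap {n : ℕ} {ρ : Equiv.Perm (Fin n)} (hρ : ρ.IsCycle) {v i : Fin n}
    (hfix : ∀ k, ρ k = k ↔ k = v) (hi : i ≠ v) : IsTour (ρ * Equiv.swap v i) := by
  have hv : ρ v = v := (hfix v).2 rfl
  constructor
  · rw [Equiv.mul_swap_eq_swap_mul, hv]
    exact hρ.swap_mul_of_apply_eq hv fun h => hi ((hfix i).1 (ρ.injective h))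
  · refine Finset.eq_univ_of_forall fun k => ?_
    rw [Equiv.Perm.mem_support, Equiv.Perm.mul_apply]
    rcases eq_or_ne k v with rfl | hkv
    · rw [Equiv.swap_apply_left]
      exact fun h => hi (ρ.injective (h.trans hv.symm))
    rcases eq_or_ne k i with rfl | hki
    · rw [Equiv.swap_apply_right, hv]
      exact hkv.symm
    · rw [Equiv.swap_apply_of_ne_of_ne hkv hki]
      exact fun h => hkv ((hfix k).1 h)

theorem linCost_mul_swap {n : ℕ} (C : Fin n → Fin n → ℝ) {ρ : Equiv.Perm (Fin n)} {v : Fin n}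
    (hv : ρ v = v) (i : Fin n) :
    linCost C (ρ * Equiv.swap v i) =
      linCost C ρ + (C v (ρ i) - C v v) + (C i v - C i (ρ i)) := by
  have key : ∀ k, C k ((ρ * Equiv.swap v i) k) = C k (ρ k) +
      (if k = v then C v (ρ i) - C v v else 0) + (if k = i then C i v - C i (ρ i) else 0) := by
    intro k
    rw [Equiv.Perm.mul_apply]
    rcases eq_or_ne k v with rfl | hkv
    · by_cases hki : k = i
      · subst hki
        simp [hv]
      · simp [hv, hki]
    rcases eq_or_ne k i with rfl | hki
    · simp [hv, hkv]
    · simp [Equiv.swap_apply_of_ne_of_ne hkv hki, hkv, hki]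
  simp only [linCost, key, Finset.sum_add_distrib, Finset.sum_ite_eq', Finset.mem_univ, if_true]

/-- Every arc avoiding `v` lies on a cycle through all the vertices other than `v`. -/
theorem exists_isCycle_apply_eq {α : Type*} [Fintype α] [DecidableEq α] {v i j : α}
    (hij : i ≠ j) (hi : i ≠ v) (hj : j ≠ v) :
    ∃ ρ : Equiv.Perm α, ρ.IsCycle ∧ (∀ k, ρ k = k ↔ k = v) ∧ ρ i = j := by
  let l := i :: j :: (Finset.univ \ {v, i, j} : Finset α).toList
  have hl : l.Nodup := by simp [l, hij, Finset.nodup_toList]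
  refine ⟨l.formPerm, List.isCycle_formPerm hl (by simp [l]), fun k => ?_,
    List.formPerm_apply_head _ _ _ hl⟩
  have hs := List.support_formPerm_of_nodup l hl (by simp [l])
  rw [← Equiv.Perm.notMem_support, hs]
  by_cases hki : k = i
  · subst hki
    simp [l, hi]
  by_cases hkj : k = j
  · subst hkj
    simp [l, hj]
  · simp [l, hki, hkj]

/-- If all tours cost `K`, the cost of a cycle through all the vertices other than `v`
is determined by `K` and the costs of the arcs at `v`. -/
theorem linCost_of_forall_isTour {n : ℕ} {C : Fin n → Fin n → ℝ} {K : ℝ}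
    (hK : ∀ σ : Equiv.Perm (Fin n), IsTour σ → linCost C σ = K) {ρ : Equiv.Perm (Fin n)}
    (hρ : ρ.IsCycle) {v : Fin n} (hfix : ∀ k, ρ k = k ↔ k = v) :
    ((n : ℝ) - 2) * linCost C ρ =
      ((n : ℝ) - 1) * K + n * C v v - ∑ i, C v i - ∑ i, C i v := by
  have hv : ρ v = v := (hfix v).2 rfl
  have h1 : ∑ i, linCost C (ρ * Equiv.swap v i) = ((n : ℝ) - 1) * K + linCost C ρ := by
    rw [← Finset.add_sum_erase _ _ (Finset.mem_univ v),
      Finset.sum_congr rfl fun i hi => hK _ (isTour_mul_swap hρ hfix (Finset.ne_of_mem_erase hi)),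
      Equiv.swap_self, ← Equiv.Perm.one_def, mul_one]
    have : 1 ≤ n := v.pos
    simp [Nat.cast_sub this]
    ring
  have h2 : ∑ i, C v (ρ i) = ∑ i, C v i := Equiv.sum_comp ρ (C v)
  simp only [linCost_mul_swap C hv, Finset.sum_add_distrib, Finset.sum_sub_distrib, h2,
    Finset.sum_const, Finset.card_univ, Fintype.card_fin, nsmul_eq_mul] at h1
  have h3 : ∑ i, C i (ρ i) = linCost C ρ := rfl
  linarith

theorem linCost_eq_of_weak_sum {n : ℕ} {C : Fin n → Fin n → ℝ} {a b : Fin n → ℝ}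
    (hC : ∀ i j : Fin n, i ≠ j → C i j = a i + b j) {σ : Equiv.Perm (Fin n)} (hσ : IsTour σ) :
    linCost C σ = ∑ i, (a i + b i) := by
  have hne : ∀ i, i ≠ σ i := fun i =>
    (Equiv.Perm.mem_support.1 (hσ.2 ▸ Finset.mem_univ i)).symm
  rw [linCost, Finset.sum_congr rfl fun i _ => hC i (σ i) (hne i), Finset.sum_add_distrib,
    Finset.sum_add_distrib, Equiv.sum_comp σ b]

theorem exists_weak_sum_of_forall_isTour {n : ℕ} (hn : 3 ≤ n) {C : Fin n → Fin n → ℝ} {K : ℝ}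
    (hK : ∀ σ : Equiv.Perm (Fin n), IsTour σ → linCost C σ = K) :
    ∃ a b : Fin n → ℝ, ∀ i j : Fin n, i ≠ j → C i j = a i + b j := by
  let v : Fin n := ⟨0, by omega⟩
  let L := (((n : ℝ) - 1) * K + n * C v v - ∑ i, C v i - ∑ i, C i v) / ((n : ℝ) - 2)
  let d := K - L + C v v
  have h_arc : ∀ i j, i ≠ j → i ≠ v → j ≠ v → C i j = C i v + (C v j - d) := by
    intro i j hij hi hj
    obtain ⟨ρ, hρ, hfix, rfl⟩ := exists_isCycle_apply_eq hij hi hj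
    have hpos : (n : ℝ) - 2 ≠ 0 := by
      have : (3 : ℝ) ≤ n := by exact_mod_cast hn
      linarith
    have hL : linCost C ρ = L := by
      rw [eq_div_iff hpos, mul_comm]
      exact linCost_of_forall_isTour hK hρ hfix
    have htour := hK _ (isTour_mul_swap hρ hfix hi)
    rw [linCost_mul_swap C ((hfix v).2 rfl), hL] at htour
    simp only [d]
    linarith
  refine ⟨fun i => if i = v then d else C i v, fun j => if j = v then 0 else C v j - d,
    fun i j hij => ?_⟩
  by_cases hi : i = v
  · have hj : j ≠ v := fun h => hij (hi.trans h.symm)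
    simp [hi, hj]
  by_cases hj : j = v
  · simp [hi, hj]
  · simpa [hi, hj] using h_arc i j hij hi hj

/-- `C` satisfies the constant value property iff it is a weak sum matrix;
moreover, in this case the common tour cost is `∑ i, (a i + b i)`. -/
theorem cvp_iff_weak_sum (n : ℕ) (hn : 3 ≤ n) (C : Fin n → Fin n → ℝ) :
    ((∃ K : ℝ, ∀ σ : Equiv.Perm (Fin n), IsTour σ → linCost C σ = K) ↔
      (∃ a b : Fin n → ℝ, ∀ i j : Fin n, i ≠ j → C i j = a i + b j)) ∧
    (∀ a b : Fin n → ℝ, (∀ i j : Fin n, i ≠ j → C i j = a i + b j) →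
      ∀ σ : Equiv.Perm (Fin n), IsTour σ → linCost C σ = ∑ i, (a i + b i)) := by
  refine ⟨⟨fun ⟨K, hK⟩ => exists_weak_sum_of_forall_isTour hn hK, fun ⟨a, b, hC⟩ =>
    ⟨_, fun σ hσ => linCost_eq_of_weak_sum hC hσ⟩⟩, fun a b hC σ hσ => ?_⟩
  exact linCost_eq_of_weak_sum hC hσ
end

section
/- Let n ≥ 3 and let Q be any quadratic cost matrix on the complete directed graph on {1,…,n}. Then there exist a quadratic cost matrix Q^R in quadratic reduced form and a linear cost matrix L such that Q[τ] = Q^R[τ] + L(τ) for every tour τ. -/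
open Finset

/-- `Q` is in quadratic reduced form relative to the distinguished vertex `v`
(playing the role of vertex `n`): it is symmetric, has zero diagonal, and all
entries whose row or column index is an arc incident to `v` are zero. -/
def InReducedForm {n : ℕ} (v : Fin n) (Q : Fin n × Fin n → Fin n × Fin n → ℝ) : Prop :=
  (∀ e f : Fin n × Fin n, Q e f = Q f e) ∧
  (∀ e : Fin n × Fin n, Q e e = 0) ∧
  (∀ e f : Fin n × Fin n, (e.1 = v ∨ e.2 = v ∨ f.1 = v ∨ f.2 = v) → Q e f = 0)

/-- Subtract from each row `Q e ·`, read as a linear cost matrix, the row and column potentials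
that make it vanish on all arcs incident to `v`. -/
def reduceRight {n : ℕ} (v : Fin n) (Q : Fin n × Fin n → Fin n × Fin n → ℝ) :
    Fin n × Fin n → Fin n × Fin n → ℝ :=
  fun e f => Q e f - Q e (f.1, v) - Q e (v, f.2) + Q e (v, v)

lemma reduceRight_eq_zero {n : ℕ} (v : Fin n) (Q : Fin n × Fin n → Fin n × Fin n → ℝ)
    (e f : Fin n × Fin n) (hf : f.1 = v ∨ f.2 = v) : reduceRight v Q e f = 0 := by
  obtain ⟨k, l⟩ := f
  rcases hf with rfl | rfl <;> simp [reduceRight]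

lemma exists_quadCost_eq_reduceRight_add {n : ℕ} (v : Fin n)
    (Q : Fin n × Fin n → Fin n × Fin n → ℝ) :
    ∃ C : Fin n → Fin n → ℝ, ∀ σ : Equiv.Perm (Fin n),
      quadCost Q σ = quadCost (reduceRight v Q) σ + linCost C σ := by
  refine ⟨fun i j => ∑ k, (Q (i, j) (k, v) + Q (i, j) (v, k) - Q (i, j) (v, v)), fun σ => ?_⟩
  simp only [quadCost, linCost, ← Finset.sum_add_distrib]
  refine Finset.sum_congr rfl fun i _ => ?_
  have h : ∑ k, Q (i, σ i) (v, σ k) = ∑ k, Q (i, σ i) (v, k) :=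
    Equiv.sum_comp σ fun k => Q (i, σ i) (v, k)
  simp only [reduceRight, Finset.sum_add_distrib, Finset.sum_sub_distrib, h]
  ring

lemma quadCost_swap {n : ℕ} (Q : Fin n × Fin n → Fin n × Fin n → ℝ)
    (σ : Equiv.Perm (Fin n)) : quadCost (fun e f => Q f e) σ = quadCost Q σ :=
  Finset.sum_comm

/-- The symmetric part of `Q`, with the diagonal set to zero. -/
noncomputable def symmOffDiag {n : ℕ} (Q : Fin n × Fin n → Fin n × Fin n → ℝ) :
    Fin n × Fin n → Fin n × Fin n → ℝ :=
  fun e f => if e = f then 0 else (Q e f + Q f e) / 2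

lemma exists_quadCost_eq_symmOffDiag_add {n : ℕ} (Q : Fin n × Fin n → Fin n × Fin n → ℝ) :
    ∃ C : Fin n → Fin n → ℝ, ∀ σ : Equiv.Perm (Fin n),
      quadCost Q σ = quadCost (symmOffDiag Q) σ + linCost C σ := by
  refine ⟨fun i j => Q (i, j) (i, j), fun σ => ?_⟩
  have h : quadCost (symmOffDiag Q) σ + linCost (fun i j => Q (i, j) (i, j)) σ =
      ∑ i, ∑ j, (Q (i, σ i) (j, σ j) / 2 + Q (j, σ j) (i, σ i) / 2) := by
    simp only [quadCost, linCost, ← Finset.sum_add_distrib]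
    refine Finset.sum_congr rfl fun i _ => ?_
    rw [← Finset.sum_ite_eq_of_mem Finset.univ i (fun j => Q (j, σ j) (j, σ j))
      (Finset.mem_univ i), ← Finset.sum_add_distrib]
    refine Finset.sum_congr rfl fun j _ => ?_
    by_cases hij : i = j
    · subst hij
      simp [symmOffDiag]
    · simp [symmOffDiag, hij, add_div]
  have hs := quadCost_swap Q σ
  simp only [quadCost] at hs
  rw [h]
  simp only [Finset.sum_add_distrib, ← Finset.sum_div, hs]
  simp [quadCost]

lemma linCost_add {n : ℕ} (C D : Fin n → Fin n → ℝ) (σ : Equiv.Perm (Fin n)) :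
    linCost (C + D) σ = linCost C σ + linCost D σ :=
  Finset.sum_add_distrib

lemma inReducedForm_symmOffDiag {n : ℕ} {v : Fin n} {Q : Fin n × Fin n → Fin n × Fin n → ℝ}
    (h : ∀ e f : Fin n × Fin n, (e.1 = v ∨ e.2 = v ∨ f.1 = v ∨ f.2 = v) → Q e f = 0) :
    InReducedForm v (symmOffDiag Q) := by
  refine ⟨fun e f => ?_, fun e => by simp [symmOffDiag], fun e f hef => ?_⟩
  · simp only [symmOffDiag, eq_comm (a := e), add_comm (Q e f)]
  · simp [symmOffDiag, h e f hef, h f e (by tauto)]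

lemma reduceRight_swap_reduceRight_eq_zero {n : ℕ} (v : Fin n)
    (Q : Fin n × Fin n → Fin n × Fin n → ℝ) (e f : Fin n × Fin n)
    (h : e.1 = v ∨ e.2 = v ∨ f.1 = v ∨ f.2 = v) :
    reduceRight v (fun e f => reduceRight v Q f e) e f = 0 := by
  by_cases hf : f.1 = v ∨ f.2 = v
  · exact reduceRight_eq_zero v _ e f hf
  · have he : e.1 = v ∨ e.2 = v := by tauto
    rw [reduceRight]
    simp [reduceRight_eq_zero v Q _ e he]

/-- every quadratic cost matrix admits a QRF decomposition. -/
theorem exists_qrf_decomposition (n : ℕ) (hn : 3 ≤ n)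
    (Q : Fin n × Fin n → Fin n × Fin n → ℝ) :
    ∃ (QR : Fin n × Fin n → Fin n × Fin n → ℝ) (L : Fin n → Fin n → ℝ),
      InReducedForm (⟨n - 1, by omega⟩ : Fin n) QR ∧
      ∀ σ : Equiv.Perm (Fin n), IsTour σ →
        quadCost Q σ = quadCost QR σ + linCost L σ := by
  obtain ⟨C, hC⟩ := exists_quadCost_eq_reduceRight_add ⟨n - 1, by omega⟩ Q
  obtain ⟨D, hD⟩ := exists_quadCost_eq_reduceRight_add ⟨n - 1, by omega⟩
    fun e f => reduceRight ⟨n - 1, by omega⟩ Q f e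
  obtain ⟨E, hE⟩ := exists_quadCost_eq_symmOffDiag_add
    (reduceRight ⟨n - 1, by omega⟩ fun e f => reduceRight ⟨n - 1, by omega⟩ Q f e)
  refine ⟨_, E + (D + C),
    inReducedForm_symmOffDiag (reduceRight_swap_reduceRight_eq_zero _ Q), fun σ _ => ?_⟩
  rw [hC, ← quadCost_swap (reduceRight _ Q), hD, hE, linCost_add, linCost_add, add_assoc,
    add_assoc]
end

section
/- Let n ≥ 3 and suppose a quadratic cost matrix Q^R on the complete directed graph on {1,…,n} is in quadratic reduced form and is linearizable. Then there exists a linearization C of Q^R such that c_{in} = 0 and c_{ni} = 0 for all i ∈ {1,…,n−1}. -/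
open Finset

/-- Adding row and column potentials of total weight zero does not change the cost of a tour. -/
theorem linCost_add_potentials {n : ℕ} (C : Fin n → Fin n → ℝ) (a b : Fin n → ℝ)
    (hab : ∑ i, a i + ∑ i, b i = 0) (σ : Equiv.Perm (Fin n)) :
    linCost (fun i j => C i j + a i + b j) σ = linCost C σ := by
  simp only [linCost, Finset.sum_add_distrib, Equiv.sum_comp σ b]
  linarith

/-- Any linear cost matrix on at least three vertices has the same tour costs as one vanishing on
all arcs incident to a given vertex. -/
theorem exists_linCost_eq_with_zeros {n : ℕ} (hn : 3 ≤ n) (v : Fin n) (C : Fin n → Fin n → ℝ) :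
    ∃ C' : Fin n → Fin n → ℝ, (∀ σ : Equiv.Perm (Fin n), linCost C' σ = linCost C σ) ∧
      ∀ i : Fin n, i ≠ v → C' i v = 0 ∧ C' v i = 0 := by
  have hn' : (n : ℝ) - 2 ≠ 0 := by
    have : (3 : ℝ) ≤ n := by exact_mod_cast hn
    linarith
  obtain ⟨s, hs⟩ : ∃ s : ℝ, s * ((n : ℝ) - 2) = 2 * C v v - (∑ i, C i v + ∑ i, C v i) :=
    ⟨_, div_mul_cancel₀ _ hn'⟩
  refine ⟨_, linCost_add_potentials C
    (fun i => -C i v + if i = v then C v v + s else 0)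
    (fun j => -C v j - s + if j = v then C v v + s else 0) ?_, fun i hi => ?_⟩
  · simp only [Finset.sum_add_distrib, Finset.sum_sub_distrib, Finset.sum_neg_distrib,
      Finset.sum_ite_eq', Finset.mem_univ, if_true, Finset.sum_const, Finset.card_univ,
      Fintype.card_fin, nsmul_eq_mul]
    linarith
  · constructor <;> simp [hi]

/-- a linearizable matrix in quadratic reduced form admits a linearization
vanishing on all arcs incident to the distinguished vertex. -/
theorem exists_linearization_with_zeros (n : ℕ) (hn : 3 ≤ n)
    (QR : Fin n × Fin n → Fin n × Fin n → ℝ)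
    (hred : InReducedForm (⟨n - 1, by omega⟩ : Fin n) QR)
    (hlin : Linearizable QR) :
    ∃ C : Fin n → Fin n → ℝ,
      (∀ σ : Equiv.Perm (Fin n), IsTour σ → quadCost QR σ = linCost C σ) ∧
      (∀ i : Fin n, i ≠ (⟨n - 1, by omega⟩ : Fin n) →
        C i (⟨n - 1, by omega⟩ : Fin n) = 0 ∧ C (⟨n - 1, by omega⟩ : Fin n) i = 0) := by
  obtain ⟨C, hC⟩ := hlin
  obtain ⟨C', hC', hzero⟩ := exists_linCost_eq_with_zeros hn ⟨n - 1, by omega⟩ C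
  exact ⟨C', fun σ hσ => (hC σ hσ).trans (hC' σ).symm, hzero⟩
end

section
/- Let n ≥ 4 and let Q^R be a quadratic cost matrix in quadratic reduced form on the complete directed graph on {1,…,n}. Then Q^R is linearizable if and only if there exists a real matrix F = (f_{ij}) indexed by the arcs of the complete directed graph on {1,…,n−1} such that: (1) for every tour τ on {1,…,n−1} and all arcs (i,j), (k,ℓ) ∈ τ, one has Z^{ij}(τ) − Z^{kℓ}(τ) = ½(f_{ij} − f_{kℓ}); and (2) the matrix ((n−2)/(n−3))·F is a linearization of Q̄, i.e., Q̄[τ] = ((n−2)/(n−3))·F(τ) for every tour τ on {1,…,n−1}. -/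
open Finset

/-- The principal submatrix `Q̄` of a quadratic cost matrix on `Fin n`, obtained by
restricting to pairs of arcs lying within the first `n - 1` vertices. -/
def Qbar {n : ℕ} (Q : Fin n × Fin n → Fin n × Fin n → ℝ) :
    Fin (n - 1) × Fin (n - 1) → Fin (n - 1) × Fin (n - 1) → ℝ :=
  fun e f =>
    Q (Fin.castLE (Nat.sub_le n 1) e.1, Fin.castLE (Nat.sub_le n 1) e.2)
      (Fin.castLE (Nat.sub_le n 1) f.1, Fin.castLE (Nat.sub_le n 1) f.2)

/-- The linear cost matrix `Z^{ij}` on the first `n - 1` vertices: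
`z^{ij}_{uv} = q̄_{(i,j),(u,v)}` for `(u,v) ≠ (i,j)` and `z^{ij}_{ij} = 0`. -/
def Zmat {n : ℕ} (Q : Fin n × Fin n → Fin n × Fin n → ℝ) (i j : Fin (n - 1)) :
    Fin (n - 1) → Fin (n - 1) → ℝ :=
  fun u v => if (u, v) = (i, j) then 0 else Qbar Q (i, j) (u, v)

/-- A permutation of `Fin m` with `2 ≤ m` is a tour iff its only nonempty invariant set is
everything. -/
theorem isTour_iff_forall_invariant {m : ℕ} (hm : 2 ≤ m) (σ : Equiv.Perm (Fin m)) :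
    IsTour σ ↔ ∀ S : Set (Fin m), S.Nonempty → (∀ x ∈ S, σ x ∈ S) → ∀ x, x ∈ S := by
  constructor
  · rintro ⟨hc, hs⟩ S ⟨x, hx⟩ hS y
    have moved : ∀ z, σ z ≠ z := fun z => by
      rw [← Equiv.Perm.mem_support, hs]
      exact mem_univ z
    obtain ⟨k, rfl⟩ := hc.exists_pow_eq (moved x) (moved y)
    induction k with
    | zero => simpa using hx
    | succ k ih =>
      rw [pow_succ', Equiv.Perm.mul_apply]
      exact hS _ ih
  · intro h
    have moved : ∀ z, σ z ≠ z := by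
      intro z hz
      have hall := h {z} ⟨z, rfl⟩ (by simpa using hz)
      have h0 := hall ⟨0, by omega⟩
      have h1 := hall ⟨1, by omega⟩
      simp only [Set.mem_singleton_iff] at h0 h1
      simpa using h0.trans h1.symm
    refine ⟨⟨⟨0, by omega⟩, moved _, fun y _ => ?_⟩, ?_⟩
    · refine h {y | σ.SameCycle ⟨0, by omega⟩ y} ⟨_, Equiv.Perm.SameCycle.refl _ _⟩ ?_ y
      exact fun x hx => Equiv.Perm.sameCycle_apply_right.2 hx
    · ext z
      simpa using moved z

/-- `σ` arises from `τ` by inserting the last vertex into the arc `(i, τ i)`. -/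
structure IsInsertion {m : ℕ} (σ : Equiv.Perm (Fin (m + 1))) (τ : Equiv.Perm (Fin m))
    (i : Fin m) : Prop where
  apply_self : σ i.castSucc = Fin.last m
  apply_last : σ (Fin.last m) = (τ i).castSucc
  apply_of_ne : ∀ j, j ≠ i → σ j.castSucc = (τ j).castSucc

theorem IsInsertion.isTour_iff {m : ℕ} (hm : 2 ≤ m) {σ : Equiv.Perm (Fin (m + 1))}
    {τ : Equiv.Perm (Fin m)} {i : Fin m} (h : IsInsertion σ τ i) : IsTour σ ↔ IsTour τ := by
  rw [isTour_iff_forall_invariant (by omega), isTour_iff_forall_invariant hm]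
  constructor
  · intro hσ T ⟨t, ht⟩ hT x
    have key := hσ {y | (∃ x ∈ T, y = x.castSucc) ∨ (y = Fin.last m ∧ i ∈ T)}
      ⟨t.castSucc, Or.inl ⟨t, ht, rfl⟩⟩ ?_ x.castSucc
    · rcases key with ⟨y, hy, hxy⟩ | ⟨hx, -⟩
      · rwa [Fin.castSucc_injective m hxy]
      · exact absurd hx (Fin.castSucc_lt_last x).ne
    · rintro y (⟨x, hx, rfl⟩ | ⟨rfl, hi⟩)
      · by_cases hxi : x = i
        · subst hxi
          exact Or.inr ⟨h.apply_self, hx⟩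
        · exact Or.inl ⟨τ x, hT x hx, h.apply_of_ne x hxi⟩
      · exact Or.inl ⟨τ i, hT i hi, h.apply_last⟩
  · intro hτ S ⟨s, hs⟩ hS
    have step : ∀ x : Fin m, x.castSucc ∈ S → (τ x).castSucc ∈ S := by
      intro x hx
      by_cases hxi : x = i
      · subst hxi
        rw [← h.apply_last, ← h.apply_self]
        exact hS _ (hS _ hx)
      · rw [← h.apply_of_ne x hxi]
        exact hS _ hx
    have key : ∀ x : Fin m, x.castSucc ∈ S := by
      refine hτ {x | x.castSucc ∈ S} ?_ step
      rcases Fin.eq_castSucc_or_eq_last s with ⟨t, rfl⟩ | rfl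
      · exact ⟨t, hs⟩
      · refine ⟨τ i, ?_⟩
        rw [Set.mem_ofPred_eq, ← h.apply_last]
        exact hS _ hs
    intro y
    rcases Fin.eq_castSucc_or_eq_last y with ⟨t, rfl⟩ | rfl
    · exact key t
    · rw [← h.apply_self]
      exact hS _ (key i)

theorem exists_isInsertion {m : ℕ} (τ : Equiv.Perm (Fin m)) (i : Fin m) :
    ∃ σ, IsInsertion σ τ i := by
  refine ⟨finSuccEquivLast.symm.permCongr τ.optionCongr *
    Equiv.swap i.castSucc (Fin.last m), ?_, ?_, ?_⟩
  · simp
  · simp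
  · intro j hj
    have hji : j.castSucc ≠ i.castSucc := fun e => hj (Fin.castSucc_injective m e)
    simp [Equiv.swap_apply_of_ne_of_ne hji (Fin.castSucc_lt_last j).ne]

theorem exists_isInsertion_of_apply_last_ne {m : ℕ} (σ : Equiv.Perm (Fin (m + 1)))
    (hσ : σ (Fin.last m) ≠ Fin.last m) : ∃ τ i, IsInsertion σ τ i := by
  obtain ⟨i, hi⟩ | hi := Fin.eq_castSucc_or_eq_last (σ.symm (Fin.last m))
  · have hσi : σ i.castSucc = Fin.last m := by rw [← hi, Equiv.apply_symm_apply]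
    let e : Option (Fin m) ≃ Option (Fin m) := finSuccEquivLast.permCongr σ
    have he : ∀ x, finSuccEquivLast.symm (e x) = σ (finSuccEquivLast.symm x) := fun x => by
      simp [e]
    refine ⟨e.removeNone, i, hσi, ?_, ?_⟩
    · have hn : e (some i) = none := by
        apply finSuccEquivLast.symm.injective
        simp [he, hσi]
      rw [← finSuccEquivLast_symm_some, e.removeNone_none hn, he, finSuccEquivLast_symm_none]
    · intro j hj
      have hne : e (some j) ≠ none := fun hn => by
        have := he (some j)
        rw [hn, finSuccEquivLast_symm_none, finSuccEquivLast_symm_some, ← hσi] at this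
        exact hj (Fin.castSucc_injective m (σ.injective this)).symm
      rw [← finSuccEquivLast_symm_some (e.removeNone j),
        e.removeNone_some (Option.ne_none_iff_exists'.1 hne), he, finSuccEquivLast_symm_some]
  · refine absurd ?_ hσ
    rw [Equiv.symm_apply_eq] at hi
    exact hi.symm

theorem IsInsertion.linCost_eq {m : ℕ} {σ : Equiv.Perm (Fin (m + 1))} {τ : Equiv.Perm (Fin m)}
    {i : Fin m} (h : IsInsertion σ τ i) (C : Fin (m + 1) → Fin (m + 1) → ℝ) :
    linCost C σ = linCost (fun u v => C u.castSucc v.castSucc) τ - C i.castSucc (τ i).castSucc +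
      C i.castSucc (Fin.last m) + C (Fin.last m) (τ i).castSucc := by
  unfold linCost
  rw [Fin.sum_univ_castSucc, ← add_sum_erase _ _ (mem_univ i), h.apply_self, h.apply_last,
    ← add_sum_erase univ (fun j => C (Fin.castSucc j) (τ j).castSucc) (mem_univ i),
    sum_congr rfl fun j hj => by rw [h.apply_of_ne j (ne_of_mem_erase hj)]]
  ring

theorem linCost_Zmat {m : ℕ} (Q : Fin (m + 1) × Fin (m + 1) → Fin (m + 1) × Fin (m + 1) → ℝ)
    (hdiag : ∀ e, Q e e = 0) (τ : Equiv.Perm (Fin m)) (i : Fin m) :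
    linCost (Zmat Q i (τ i)) τ =
      ∑ j : Fin m, Q (i.castSucc, (τ i).castSucc) (j.castSucc, (τ j).castSucc) := by
  refine sum_congr rfl fun j _ => ?_
  by_cases hj : j = i
  · subst hj
    rw [hdiag]
    exact if_pos rfl
  · exact if_neg fun e => hj (congrArg Prod.fst e)

theorem sum_linCost_Zmat {m : ℕ} (Q : Fin (m + 1) × Fin (m + 1) → Fin (m + 1) × Fin (m + 1) → ℝ)
    (hdiag : ∀ e, Q e e = 0) (τ : Equiv.Perm (Fin m)) :
    ∑ i : Fin m, linCost (Zmat Q i (τ i)) τ = quadCost (Qbar Q) τ :=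
  sum_congr rfl fun i _ => linCost_Zmat Q hdiag τ i

theorem IsInsertion.quadCost_eq {m : ℕ} {σ : Equiv.Perm (Fin (m + 1))} {τ : Equiv.Perm (Fin m)}
    {i : Fin m} (h : IsInsertion σ τ i)
    {Q : Fin (m + 1) × Fin (m + 1) → Fin (m + 1) × Fin (m + 1) → ℝ}
    (hQ : InReducedForm (Fin.last m) Q) :
    quadCost Q σ = quadCost (Qbar Q) τ - 2 * linCost (Zmat Q i (τ i)) τ := by
  obtain ⟨hsymm, hdiag, hlast⟩ := hQ
  let q : Fin m → Fin m → ℝ := fun x y =>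
    Q (x.castSucc, (τ x).castSucc) (y.castSucc, (τ y).castSucc)
  have hrow : ∀ y, Q (Fin.last m, σ (Fin.last m)) y = 0 := fun y => hlast _ _ (by simp)
  have hcol : ∀ x, Q x (Fin.last m, σ (Fin.last m)) = 0 := fun x => hlast _ _ (by simp)
  have hqi : q i i = 0 := hdiag _
  have entry : ∀ x y : Fin m, Q (x.castSucc, σ x.castSucc) (y.castSucc, σ y.castSucc) =
      q x y - (if x = i then q i y else 0) - (if y = i then q x i else 0) := by
    intro x y
    by_cases hx : x = i
    · subst hx
      rw [hlast _ _ (by simp [h.apply_self])]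
      by_cases hy : y = x
      · subst hy
        simp [hqi]
      · simp [hy]
    · by_cases hy : y = i
      · subst hy
        rw [hlast _ _ (by simp [h.apply_self])]
        simp [hx]
      · simp [hx, hy, q, h.apply_of_ne x hx, h.apply_of_ne y hy]
  have hsum : quadCost Q σ = ∑ x, ∑ y, q x y - ∑ y, q i y - ∑ x, q x i := by
    unfold quadCost
    simp only [Fin.sum_univ_castSucc, hrow, hcol, entry, sum_sub_distrib, sum_const_zero,
      add_zero]
    rw [sum_comm (f := fun x y => if x = i then q i y else 0)]
    simp
  have hcomm : ∑ x, q x i = ∑ y, q i y := sum_congr rfl fun x _ => hsymm _ _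
  have hbar : quadCost (Qbar Q) τ = ∑ x, ∑ y, q x y := rfl
  rw [hsum, hcomm, linCost_Zmat Q hdiag, hbar]
  ring

/-- The cost of a tour on `m + 1` vertices splits along the vertex insertion producing it. -/
theorem linearizable_iff_exists_insertion_cost {m : ℕ} (hm : 2 ≤ m)
    {Q : Fin (m + 1) × Fin (m + 1) → Fin (m + 1) × Fin (m + 1) → ℝ}
    (hQ : InReducedForm (Fin.last m) Q) :
    Linearizable Q ↔ ∃ F : Fin m → Fin m → ℝ, ∀ τ : Equiv.Perm (Fin m), IsTour τ → ∀ i,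
      quadCost (Qbar Q) τ - 2 * linCost (Zmat Q i (τ i)) τ = linCost F τ - F i (τ i) := by
  constructor
  · rintro ⟨C, hC⟩
    let a : Fin m → ℝ := fun u => C u.castSucc (Fin.last m)
    let b : Fin m → ℝ := fun v => C (Fin.last m) v.castSucc
    let d : ℝ := (∑ u, a u + ∑ v, b v) / (m - 1)
    refine ⟨fun u v => C u.castSucc v.castSucc - a u - b v + d, fun τ hτ i => ?_⟩
    obtain ⟨σ, hσ⟩ := exists_isInsertion τ i
    rw [← hσ.quadCost_eq hQ, hC σ ((hσ.isTour_iff hm).2 hτ), hσ.linCost_eq]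
    have hd : (m : ℝ) * d = d + (∑ u, a u + ∑ v, b v) := by
      have : (m : ℝ) - 1 ≠ 0 := by
        have : (2 : ℝ) ≤ m := by exact_mod_cast hm
        linarith
      simp only [d]
      field_simp
      ring
    have hb : ∑ u, b (τ u) = ∑ v, b v := Equiv.sum_comp τ b
    simp only [linCost, sum_add_distrib, sum_sub_distrib, sum_const, card_univ, Fintype.card_fin,
      nsmul_eq_mul, hd, hb]
    simp only [a, b]
    ring
  · rintro ⟨F, hF⟩
    let C : Fin (m + 1) → Fin (m + 1) → ℝ := fun u v =>
      Fin.lastCases (motive := fun _ => ℝ) 0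
        (fun u => Fin.lastCases (motive := fun _ => ℝ) 0 (fun v => F u v) v) u
    refine ⟨C, fun σ hσ => ?_⟩
    have hne : σ (Fin.last m) ≠ Fin.last m := by
      rw [← Equiv.Perm.mem_support, hσ.2]
      exact mem_univ _
    obtain ⟨τ, i, h⟩ := exists_isInsertion_of_apply_last_ne σ hne
    rw [h.quadCost_eq hQ, hF τ ((h.isTour_iff hm).1 hσ), h.linCost_eq]
    simp [C]

/-- characterization of linearizability of a matrix in quadratic reduced form. -/
theorem linearizable_characterization (n : ℕ) (hn : 4 ≤ n)
    (QR : Fin n × Fin n → Fin n × Fin n → ℝ)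
    (hred : InReducedForm (⟨n - 1, by omega⟩ : Fin n) QR) :
    Linearizable QR ↔
      ∃ F : Fin (n - 1) → Fin (n - 1) → ℝ,
        (∀ τ : Equiv.Perm (Fin (n - 1)), IsTour τ → ∀ i k : Fin (n - 1),
          linCost (Zmat QR i (τ i)) τ - linCost (Zmat QR k (τ k)) τ =
            (F i (τ i) - F k (τ k)) / 2) ∧
        (∀ τ : Equiv.Perm (Fin (n - 1)), IsTour τ →
          quadCost (Qbar QR) τ = ((n : ℝ) - 2) / ((n : ℝ) - 3) * linCost F τ) := by
  obtain ⟨m, rfl⟩ : ∃ m, n = m + 1 := ⟨n - 1, by omega⟩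
  have hm : (3 : ℝ) ≤ m := by exact_mod_cast (by omega : 3 ≤ m)
  have hm0 : (m : ℝ) ≠ 0 := by linarith
  have hm2 : (m : ℝ) - 2 ≠ 0 := by linarith
  have hcoef : (((m + 1 : ℕ) : ℝ) - 2) / (((m + 1 : ℕ) : ℝ) - 3) = ((m : ℝ) - 1) / (m - 2) := by
    push_cast
    congr 1 <;> ring
  rw [linearizable_iff_exists_insertion_cost (by omega) hred, hcoef]
  refine exists_congr fun F => ?_
  have hsum := sum_linCost_Zmat QR hred.2.1
  constructor
  · intro h
    refine ⟨fun τ hτ i k => ?_, fun τ hτ => ?_⟩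
    · have hi := h τ hτ i
      have hk := h τ hτ k
      linarith
    · have key : ∑ i : Fin m, (quadCost (Qbar QR) τ - 2 * linCost (Zmat QR i (τ i)) τ) =
          ∑ i : Fin m, (linCost F τ - F i (τ i)) := sum_congr rfl fun i _ => h τ hτ i
      have hF : ∑ i : Fin m, F i (τ i) = linCost F τ := rfl
      rw [sum_sub_distrib, sum_sub_distrib, ← mul_sum, hsum, hF] at key
      simp only [sum_const, card_univ, Fintype.card_fin, nsmul_eq_mul] at key
      rw [div_mul_eq_mul_div, eq_div_iff hm2]
      linarith
  · rintro ⟨hdiff, hlin⟩ τ hτ i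
    have key : ∑ k : Fin m, (linCost (Zmat QR i (τ i)) τ - linCost (Zmat QR k (τ k)) τ) =
        ∑ k : Fin m, (F i (τ i) - F k (τ k)) / 2 := sum_congr rfl fun k _ => hdiff τ hτ i k
    have hF : ∑ i : Fin m, F i (τ i) = linCost F τ := rfl
    rw [← sum_div, sum_sub_distrib, sum_sub_distrib, hsum, hF] at key
    simp only [sum_const, card_univ, Fintype.card_fin, nsmul_eq_mul] at key
    have hl := hlin τ hτ
    rw [div_mul_eq_mul_div, eq_div_iff hm2] at hl
    apply mul_left_cancel₀ hm0
    linarith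
end

section
/- Let n ≥ 4, let Q^R be a quadratic cost matrix in quadratic reduced form on the complete directed graph on {1,…,n}, let τ be a tour on {1,…,n−1}, and let (i,j) be an arc of τ. Let τ^{ij} be the tour on {1,…,n} obtained from τ by deleting the arc (i,j) and inserting the arcs (i,n) and (n,j). Then Q^R[τ^{ij}] = Q̄[τ] − 2·Z^{ij}(τ). -/
open Finset

/-- Deleting the row and the column of an index `i` from a symmetric matrix that vanishes at
`(i, i)` lowers the sum of its entries by twice the sum of row `i`. -/
theorem sum_sum_delete_index {α : Type*} [Fintype α] [DecidableEq α] (f : α → α → ℝ) (i : α)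
    (hsymm : ∀ a b, f a b = f b a) (hdiag : f i i = 0) :
    ∑ a, ∑ b, (if a = i ∨ b = i then 0 else f a b) = ∑ a, ∑ b, f a b - 2 * ∑ b, f i b := by
  have hentry : ∀ a b, (if a = i ∨ b = i then 0 else f a b) =
      f a b - (if a = i then f i b else 0) - (if b = i then f i a else 0) := by
    intro a b
    by_cases ha : a = i
    · subst ha
      by_cases hb : b = a
      · subst hb
        simp [hdiag]
      · simp [hb]
    · by_cases hb : b = i
      · subst hb
        simp [ha, hsymm a b]
      · simp [ha, hb]
  have hrow : ∑ a, ∑ b, (if a = i then f i b else 0) = ∑ b, f i b := by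
    rw [Finset.sum_comm]
    simp
  simp only [hentry, Finset.sum_sub_distrib, hrow]
  simp only [Finset.sum_ite_eq', Finset.mem_univ, if_true]
  ring

/-- if `σ = τ^{ij}` is the tour on `Fin n` obtained from a tour `τ` on the
first `n - 1` vertices by replacing the arc `(i, τ i)` with the two arcs through the
distinguished vertex, then `Q^R[τ^{ij}] = Q̄[τ] − 2·Z^{ij}(τ)`. -/
theorem quadCost_insert_vertex (n : ℕ) (hn : 4 ≤ n)
    (QR : Fin n × Fin n → Fin n × Fin n → ℝ)
    (hred : InReducedForm (⟨n - 1, by omega⟩ : Fin n) QR)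
    (τ : Equiv.Perm (Fin (n - 1))) (hτ : IsTour τ) (i : Fin (n - 1))
    (σ : Equiv.Perm (Fin n))
    (h1 : σ (Fin.castLE (Nat.sub_le n 1) i) = (⟨n - 1, by omega⟩ : Fin n))
    (h2 : σ (⟨n - 1, by omega⟩ : Fin n) = Fin.castLE (Nat.sub_le n 1) (τ i))
    (h3 : ∀ u : Fin (n - 1), u ≠ i →
      σ (Fin.castLE (Nat.sub_le n 1) u) = Fin.castLE (Nat.sub_le n 1) (τ u)) :
    quadCost QR σ = quadCost (Qbar QR) τ - 2 * linCost (Zmat QR i (τ i)) τ := by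
  obtain ⟨m, rfl⟩ : ∃ m, n = m + 1 := ⟨n - 1, by omega⟩
  obtain ⟨hsymm, hdiag, hzero⟩ := hred
  change Fin m at i
  change Equiv.Perm (Fin m) at τ
  change σ i.castSucc = Fin.last m at h1
  change ∀ e f : Fin (m + 1) × Fin (m + 1),
    (e.1 = Fin.last m ∨ e.2 = Fin.last m ∨ f.1 = Fin.last m ∨ f.2 = Fin.last m) →
      QR e f = 0 at hzero
  change ∀ u : Fin m, u ≠ i → σ u.castSucc = (τ u).castSucc at h3
  have hZ : linCost (Zmat QR i (τ i)) τ = ∑ u, Qbar QR (i, τ i) (u, τ u) := by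
    refine Finset.sum_congr rfl fun u _ => ?_
    by_cases hu : u = i
    · subst hu
      simp [Zmat, Qbar, hdiag]
    · simp [Zmat, hu]
  have hσ : quadCost QR σ =
      ∑ a : Fin m, ∑ b : Fin m, if a = i ∨ b = i then 0 else Qbar QR (a, τ a) (b, τ b) := by
    rw [quadCost, Fin.sum_univ_castSucc,
      Finset.sum_eq_zero (fun b _ => hzero (Fin.last m, _) (b, _) (Or.inl rfl)), add_zero]
    refine Finset.sum_congr rfl fun a _ => ?_
    rw [Fin.sum_univ_castSucc,
      hzero (a.castSucc, _) (Fin.last m, _) (Or.inr (Or.inr (Or.inl rfl))), add_zero]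
    refine Finset.sum_congr rfl fun b _ => ?_
    split_ifs with h
    · rcases h with rfl | rfl
      · exact hzero _ _ (Or.inr (Or.inl h1))
      · exact hzero _ _ (Or.inr (Or.inr (Or.inr h1)))
    · rw [not_or] at h
      rw [h3 a h.1, h3 b h.2]
      rfl
  rw [hσ, hZ]
  exact sum_sum_delete_index (fun a b => Qbar QR (a, τ a) (b, τ b)) i
    (fun a b => hsymm _ _) (hdiag _)
end

section
/- Let n ≥ 3 and let Q be a quadratic cost matrix on the complete directed graph on {1,…,n}. Suppose there exist real three-index arrays A = (a_{ijk}), B = (b_{ijk}), D = (d_{ijk}), H = (h_{ijk}) with indices in {1,…,n} such that q_{(i,j),(k,ℓ)} = a_{ijk} + b_{ijℓ} + d_{ikℓ} + h_{jkℓ} for all i,j,k,ℓ with i ≠ j and k ≠ ℓ. Then Q is linearizable, and a linearization is given by the linear cost matrix C with c_{ij} = α_{ij} + β_{ij} + γ_{ij} + δ_{ij}, where α_{ij} = Σ_{k=1}^{n} a_{ijk}, β_{ij} = Σ_{k=1}^{n} b_{ijk}, γ_{ij} = Σ_{k=1}^{n} d_{kij}, and δ_{ij} = Σ_{k=1}^{n}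 h_{kij}. -/
open Finset

/-- For a permutation without fixed points, a quadratic cost that splits into four three-index
arrays equals the linear cost obtained by summing out the free index of each array. -/
theorem quadCost_eq_linCost_of_fixedPointFree {n : ℕ}
    (Q : Fin n × Fin n → Fin n × Fin n → ℝ) (A B D H : Fin n → Fin n → Fin n → ℝ)
    (h : ∀ i j k l : Fin n, i ≠ j → k ≠ l →
      Q (i, j) (k, l) = A i j k + B i j l + D i k l + H j k l)
    (σ : Equiv.Perm (Fin n)) (hσ : ∀ i, σ i ≠ i) :
    quadCost Q σ = linCost (fun i j =>
      (∑ k, A i j k) + (∑ k, B i j k) + (∑ k, D k i j) + (∑ k, H k i j)) σ := by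
  have hQ : ∀ i j, Q (i, σ i) (j, σ j) =
      A i (σ i) j + B i (σ i) (σ j) + D i j (σ j) + H (σ i) j (σ j) :=
    fun i j => h _ _ _ _ (hσ i).symm (hσ j).symm
  have hB : ∀ i, ∑ j, B i (σ i) (σ j) = ∑ k, B i (σ i) k :=
    fun i => Equiv.sum_comp σ (B i (σ i))
  have hD : ∑ i, ∑ j, D i j (σ j) = ∑ i, ∑ k, D k i (σ i) := Finset.sum_comm
  have hH : ∑ i, ∑ j, H (σ i) j (σ j) = ∑ i, ∑ k, H k i (σ i) :=
    (Equiv.sum_comp σ fun i => ∑ j, H i j (σ j)).trans Finset.sum_comm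
  simp only [quadCost, linCost, hQ, Finset.sum_add_distrib, hB, hD, hH]

/-- if `q_{(i,j),(k,ℓ)} = a_{ijk} + b_{ijℓ} + d_{ikℓ} + h_{jkℓ}` for all
relevant indices, then `Q` is linearizable, with explicit linearization. -/
theorem linearizable_of_four_index_sum (n : ℕ) (hn : 3 ≤ n)
    (Q : Fin n × Fin n → Fin n × Fin n → ℝ)
    (A B D H : Fin n → Fin n → Fin n → ℝ)
    (h : ∀ i j k l : Fin n, i ≠ j → k ≠ l →
      Q (i, j) (k, l) = A i j k + B i j l + D i k l + H j k l) :
    Linearizable Q ∧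
    (∀ σ : Equiv.Perm (Fin n), IsTour σ →
      quadCost Q σ = linCost (fun i j =>
        (∑ k, A i j k) + (∑ k, B i j k) + (∑ k, D k i j) + (∑ k, H k i j)) σ) := by
  have key := fun (σ : Equiv.Perm (Fin n)) (hσ : IsTour σ) =>
    quadCost_eq_linCost_of_fixedPointFree Q A B D H h σ fun i =>
      Equiv.Perm.mem_support.mp (hσ.2 ▸ Finset.mem_univ i)
  exact ⟨⟨_, key⟩, key⟩
end

section
/- Let n ≥ 4 and let (i,j) and (k,ℓ) be arcs of the complete directed graph on {1,…,n} such that i ≠ k, j ≠ ℓ and (k,ℓ) ≠ (j,i). Then there exists a tour on {1,…,n} whose arc set contains both (i,j) and (k,ℓ). -/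
open Finset

/-- Every duplicate-free list with at least two entries is a path contained in some tour. -/
theorem exists_tour_extending_list {n : ℕ} (p : List (Fin n)) (hp : p.Nodup)
    (hlen : 2 ≤ p.length) :
    ∃ σ : Equiv.Perm (Fin n), IsTour σ ∧
      ∀ (m : ℕ) (hm : m + 1 < p.length), σ p[m] = p[m + 1] := by
  set r := (Finset.univ.filter (· ∉ p)).toList with hr
  have hnodup : (p ++ r).Nodup := by
    refine List.Nodup.append hp (Finset.nodup_toList _) fun x hx hx' => ?_
    simp [hr] at hx'
    exact hx' hx
  have hlen' : 2 ≤ (p ++ r).length := by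
    rw [List.length_append]
    omega
  refine ⟨(p ++ r).formPerm, ⟨List.isCycle_formPerm hnodup hlen', ?_⟩, fun m hm => ?_⟩
  · rw [List.support_formPerm_of_nodup _ hnodup]
    · ext x
      simp [hr, em]
    · intro x hx
      simp [hx] at hlen'
  · have h := List.formPerm_apply_lt_getElem (p ++ r) hnodup m
      (by rw [List.length_append]; omega)
    rwa [List.getElem_append_left (by omega), List.getElem_append_left hm] at h

/-- any two arcs `(i,j)` and `(k,ℓ)` with `i ≠ k`, `j ≠ ℓ` and
`(k,ℓ) ≠ (j,i)` lie on a common tour, provided `n ≥ 4`. -/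
theorem exists_tour_through_two_arcs (n : ℕ) (hn : 4 ≤ n) (i j k l : Fin n)
    (hij : i ≠ j) (hkl : k ≠ l) (hik : i ≠ k) (hjl : j ≠ l)
    (hrev : (k, l) ≠ (j, i)) :
    ∃ σ : Equiv.Perm (Fin n), IsTour σ ∧ σ i = j ∧ σ k = l := by
  by_cases hli : l = i
  · subst hli
    have hjk : j ≠ k := fun h => hrev (by rw [h])
    obtain ⟨σ, hσ, h⟩ := exists_tour_extending_list [k, l, j]
      (by simp [hkl, hij, hjk.symm]) (by simp)
    exact ⟨σ, hσ, h 1 (by simp), h 0 (by simp)⟩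
  by_cases hjk : j = k
  · subst hjk
    obtain ⟨σ, hσ, h⟩ := exists_tour_extending_list [i, j, l]
      (by simp [hij, hkl, Ne.symm hli]) (by simp)
    exact ⟨σ, hσ, h 0 (by simp), h 1 (by simp)⟩
  obtain ⟨σ, hσ, h⟩ := exists_tour_extending_list [i, j, k, l]
    (by simp [hij, hik, Ne.symm hli, hjk, hjl, hkl]) (by simp)
  exact ⟨σ, hσ, h 0 (by simp), h 2 (by simp)⟩
end

section
/- Let n ≥ 4 and let W_n be the wheel graph on n vertices. Then every quadratic cost matrix Q on the edges of W_n is linearizable over the Hamiltonian cycles of W_n; that is, for every symmetric assignment of reals q_{ef} to ordered pairs (e,f) of edges of W_n there exists a function c from the edges of W_n to ℝ such that Σ_{e∈H} Σ_{f∈H} q_{ef} = Σ_{e∈H} c(e) for every Hamiltonian cycle H of W_n. -/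
open Finset

/-- The wheel graph on `n` vertices: the hub is vertex `0`, the rim vertices are
`1, …, n-1`; the edges are the spokes `{0, i}` for `1 ≤ i ≤ n-1`, the rim edges
`{i, i+1}` for `1 ≤ i ≤ n-2` and the rim edge `{n-1, 1}`. -/
def wheel (n : ℕ) : SimpleGraph (Fin n) :=
  SimpleGraph.fromRel (fun a b =>
    a.val = 0 ∨ (1 ≤ a.val ∧ b.val = a.val + 1) ∨ (a.val = n - 1 ∧ b.val = 1))

/-- The successor of a rim vertex in the cyclic order of the rim of the wheel. -/
def rimSucc {n : ℕ} (hn : 4 ≤ n) (v : Fin n) : Fin n :=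
  if h : v.val = n - 1 then ⟨1, by omega⟩ else ⟨v.val + 1, by omega⟩

/-- The predecessor of a rim vertex in the cyclic order of the rim of the wheel. -/
def rimPred {n : ℕ} (hn : 4 ≤ n) (v : Fin n) : Fin n :=
  if v.val = 1 then ⟨n - 1, by omega⟩ else ⟨v.val - 1, by omega⟩

/-- The set of rim edges of the wheel. -/
def rim {n : ℕ} (hn : 4 ≤ n) : Finset (Sym2 (Fin n)) :=
  (univ.filter fun v : Fin n => v.val ≠ 0).image fun v => s(v, rimSucc hn v)

lemma rimSucc_val {n : ℕ} (hn : 4 ≤ n) (v : Fin n) :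
    (rimSucc hn v).val = if v.val = n - 1 then 1 else v.val + 1 := by
  unfold rimSucc; split_ifs <;> rfl

lemma rimPred_val {n : ℕ} (hn : 4 ≤ n) (v : Fin n) :
    (rimPred hn v).val = if v.val = 1 then n - 1 else v.val - 1 := by
  unfold rimPred; split_ifs <;> rfl

lemma card_rim {n : ℕ} (hn : 4 ≤ n) : (rim hn).card = n - 1 := by
  have hn0 : NeZero n := ⟨by omega⟩
  rw [rim, card_image_of_injOn]
  · have : (univ.filter fun v : Fin n => v.val ≠ 0) = univ.erase 0 := by
      ext v; simp
    rw [this, card_erase_of_mem (mem_univ _), card_univ, Fintype.card_fin]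
  · intro a ha b hb hab
    simp only [coe_filter, mem_univ, true_and, Set.mem_ofPred_eq] at ha hb
    simp only [Sym2.eq_iff, Fin.ext_iff, rimSucc_val] at hab ⊢
    split_ifs at hab <;> omega

lemma mem_rim_iff {n : ℕ} (hn : 4 ≤ n) (u v : Fin n) :
    s(u, v) ∈ rim hn ↔ (wheel n).Adj u v ∧ u.val ≠ 0 ∧ v.val ≠ 0 := by
  simp only [rim, mem_image, mem_filter, mem_univ, true_and, wheel, SimpleGraph.fromRel_adj,
    Sym2.eq_iff, Fin.ext_iff, rimSucc_val, ne_eq]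
  constructor
  · rintro ⟨a, ha, h⟩
    split_ifs at h <;> omega
  · rintro ⟨⟨huv, h⟩, hu, hv⟩
    by_cases h' : v.val = u.val + 1 ∨ (u.val = n - 1 ∧ v.val = 1)
    · exact ⟨u, hu, by split_ifs <;> omega⟩
    · exact ⟨v, hv, by split_ifs <;> omega⟩

lemma eq_of_wheel_adj {n : ℕ} (hn : 4 ≤ n) {u v : Fin n} (hv : v.val ≠ 0)
    (h : (wheel n).Adj v u) : u.val = 0 ∨ u = rimSucc hn v ∨ u = rimPred hn v := by
  simp only [wheel, SimpleGraph.fromRel_adj, ne_eq, Fin.ext_iff, rimSucc_val, rimPred_val] at h ⊢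
  split_ifs <;> omega

/-- The combinatorial properties of the edge set of a Hamiltonian cycle of the wheel
which are used for linearization. -/
structure IsTwoFactor {n : ℕ} (H : Finset (Sym2 (Fin n))) : Prop where
  adj : ∀ u v, s(u, v) ∈ H → (wheel n).Adj u v
  card_eq : H.card = n
  card_neighbors : ∀ v, (univ.filter fun u => s(v, u) ∈ H).card = 2

lemma isTwoFactor_edges {n : ℕ} {v : Fin n} {w : (wheel n).Walk v v}
    (hw : w.IsHamiltonianCycle) : IsTwoFactor w.edges.toFinset where
  adj a b h := w.edges_subset_edgeSet (List.mem_toFinset.1 h)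
  card_eq := by
    rw [List.toFinset_card_of_nodup hw.isCycle.edges_nodup, SimpleGraph.Walk.length_edges,
      hw.length_eq, Fintype.card_fin]
  card_neighbors u := by
    rw [← hw.isCycle.ncard_neighborSet_toSubgraph_eq_two (hw.mem_support u),
      ← Set.ncard_coe_finset]
    congr 1
    ext x
    simp [SimpleGraph.Walk.adj_toSubgraph_iff_mem_edges]

namespace IsTwoFactor

variable {n : ℕ} {H H' : Finset (Sym2 (Fin n))}

lemma spoke_mem_iff (hn : 4 ≤ n) (hH : IsTwoFactor H) {o v : Fin n} (ho : o.val = 0)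
    (hv : v.val ≠ 0) :
    s(v, o) ∈ H ↔ ¬ (s(v, rimSucc hn v) ∈ H ∧ s(v, rimPred hn v) ∈ H) := by
  have h2 := hH.card_neighbors v
  have hsp : rimSucc hn v ≠ rimPred hn v := by
    simp only [ne_eq, Fin.ext_iff, rimSucc_val, rimPred_val]; split_ifs <;> omega
  have hos : o ≠ rimSucc hn v := by
    simp only [ne_eq, Fin.ext_iff, rimSucc_val]; split_ifs <;> omega
  have hop : (s(v, rimPred hn v) ∈ H → o ≠ rimPred hn v) := by
    simp only [ne_eq, Fin.ext_iff, rimPred_val]; split_ifs <;> omega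
  constructor
  · rintro h ⟨hs, hp⟩
    have hsub : ({o, rimSucc hn v, rimPred hn v} : Finset (Fin n)) ⊆
        univ.filter fun u => s(v, u) ∈ H := by
      intro x hx
      simp only [mem_insert, mem_singleton] at hx
      rcases hx with rfl | rfl | rfl <;> simpa
    have := card_le_card hsub
    rw [card_eq_three.2 ⟨_, _, _, hos, hop hp, hsp, rfl⟩] at this
    omega
  · intro h
    by_contra ho'
    have hsub : (univ.filter fun u => s(v, u) ∈ H) ⊆ {rimSucc hn v, rimPred hn v} := by
      intro x hx
      simp only [mem_filter, mem_univ, true_and] at hx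
      rcases eq_of_wheel_adj hn hv (hH.adj _ _ hx) with h0 | h0
      · exact absurd hx (by rwa [Fin.ext (h0.trans ho.symm)])
      · simpa using h0
    have heq := eq_of_subset_of_card_le hsub (by rw [h2]; exact card_le_two)
    simp only [Finset.ext_iff, mem_filter, mem_univ, true_and, mem_insert, mem_singleton] at heq
    exact h ⟨(heq _).2 (.inl rfl), (heq _).2 (.inr rfl)⟩

/-- Exactly one rim edge is missing. -/
lemma card_rim_sdiff (hn : 4 ≤ n) (hH : IsTwoFactor H) : (rim hn \ H).card = 1 := by
  let o : Fin n := ⟨0, by omega⟩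
  have hspokes : H \ rim hn = (univ.filter fun u => s(o, u) ∈ H).image fun u => s(o, u) := by
    ext e
    induction e with | _ a b
    simp only [mem_sdiff, mem_rim_iff, mem_image, mem_filter, mem_univ, true_and]
    constructor
    · rintro ⟨h, h'⟩
      have : a = o ∨ b = o := by
        by_contra! hc
        exact h' ⟨hH.adj _ _ h, fun h0 => hc.1 (Fin.ext h0), fun h0 => hc.2 (Fin.ext h0)⟩
      rcases this with rfl | rfl
      · exact ⟨b, h, rfl⟩
      · exact ⟨a, Sym2.eq_swap ▸ h, Sym2.eq_swap⟩
    · rintro ⟨u, hu, h⟩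
      refine ⟨h ▸ hu, ?_⟩
      rcases Sym2.eq_iff.1 h with ⟨rfl, -⟩ | ⟨rfl, -⟩ <;> simp [o]
  have hc : (H \ rim hn).card = 2 := by
    rw [hspokes, card_image_of_injective _ fun a b h => Sym2.congr_right.1 h]
    exact hH.card_neighbors o
  have h1 := card_sdiff_add_card_inter H (rim hn)
  have h2 := card_sdiff_add_card_inter (rim hn) H
  rw [inter_comm, card_rim] at h2
  rw [hH.card_eq] at h1
  omega

lemma subset_of_rim_sdiff_eq (hn : 4 ≤ n) (hH : IsTwoFactor H) (hH' : IsTwoFactor H')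
    (h : rim hn \ H = rim hn \ H') : H ⊆ H' := by
  have hrim : ∀ e ∈ rim hn, e ∈ H ↔ e ∈ H' := fun e he => by
    simpa [he, not_iff_not] using Finset.ext_iff.1 h e
  have hspoke : ∀ v o : Fin n, v.val ≠ 0 → o.val = 0 → s(v, o) ∈ H → s(v, o) ∈ H' := by
    intro v o hv ho hvo
    rw [hH.spoke_mem_iff hn ho hv] at hvo
    rw [hH'.spoke_mem_iff hn ho hv]
    rwa [← hrim, ← hrim]
    all_goals
      simp only [mem_rim_iff, wheel, SimpleGraph.fromRel_adj, ne_eq, Fin.ext_iff, rimSucc_val,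
        rimPred_val]
      refine ⟨⟨?_, ?_⟩, hv, ?_⟩ <;> split_ifs <;> first | omega | exact not_false
  intro e he
  induction e with | _ a b
  have hab := hH.adj _ _ he
  by_cases ha : a.val = 0
  · rw [Sym2.eq_swap] at he ⊢
    exact hspoke b a (fun hb => hab.ne (Fin.ext (ha.trans hb.symm))) ha he
  · by_cases hb : b.val = 0
    · exact hspoke a b ha hb he
    · exact (hrim _ ((mem_rim_iff hn a b).2 ⟨hab, ha, hb⟩)).1 he

lemma eq_of_rim_sdiff_eq (hn : 4 ≤ n) (hH : IsTwoFactor H) (hH' : IsTwoFactor H')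
    (h : rim hn \ H = rim hn \ H') : H = H' :=
  (hH.subset_of_rim_sdiff_eq hn hH' h).antisymm (hH'.subset_of_rim_sdiff_eq hn hH h.symm)

end IsTwoFactor

/-- Every real function of the edge sets is linearizable: the value is encoded in the cost of
the unique missing rim edge. -/
lemma exists_linearization {n : ℕ} (hn : 4 ≤ n) (F : Finset (Sym2 (Fin n)) → ℝ) :
    ∃ c : Sym2 (Fin n) → ℝ, ∀ H, IsTwoFactor H → F H = ∑ e ∈ H, c e := by
  classical
  let q : Sym2 (Fin n) → ℝ := fun e =>
    if h : ∃ H, IsTwoFactor H ∧ rim hn \ H = {e} then F h.choose else 0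
  let R : ℝ := (∑ e ∈ rim hn, q e) / ((n : ℝ) - 2)
  refine ⟨fun e => if e ∈ rim hn then R - q e else 0, fun H hH => ?_⟩
  obtain ⟨r, hr⟩ := card_eq_one.1 (hH.card_rim_sdiff hn)
  have hq : q r = F H := by
    have hex : ∃ H, IsTwoFactor H ∧ rim hn \ H = {r} := ⟨H, hH, hr⟩
    simp only [q, dif_pos hex]
    rw [hex.choose_spec.1.eq_of_rim_sdiff_eq hn hH (hex.choose_spec.2.trans hr.symm)]
  have hn2 : (n : ℝ) - 2 ≠ 0 := by
    have : (4 : ℝ) ≤ n := by exact_mod_cast hn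
    linarith
  have hcard : ((rim hn).card : ℝ) = n - 1 := by
    rw [card_rim, Nat.cast_sub (by omega), Nat.cast_one]
  have hR : R * ((n : ℝ) - 2) = ∑ e ∈ rim hn, q e := div_mul_cancel₀ _ hn2
  have hsum := sum_inter_add_sum_sdiff (rim hn) H fun e => R - q e
  rw [hr, sum_singleton, sum_sub_distrib (s := rim hn), sum_const, nsmul_eq_mul, hcard] at hsum
  rw [← sum_filter, filter_mem_eq_inter, inter_comm, ← hq]
  linarith

/-- every symmetric quadratic cost matrix on the edges of the wheel graph
on `n ≥ 4` vertices is linearizable over its Hamiltonian cycles. -/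
theorem wheel_quadratic_linearizable (n : ℕ) (hn : 4 ≤ n)
    (Q : Sym2 (Fin n) → Sym2 (Fin n) → ℝ) (hsymm : ∀ e f, Q e f = Q f e) :
    ∃ c : Sym2 (Fin n) → ℝ,
      ∀ (v : Fin n) (w : (wheel n).Walk v v), w.IsHamiltonianCycle →
        ∑ e ∈ w.edges.toFinset, ∑ f ∈ w.edges.toFinset, Q e f =
          ∑ e ∈ w.edges.toFinset, c e := by
  obtain ⟨c, hc⟩ := exists_linearization hn fun H => ∑ e ∈ H, ∑ f ∈ H, Q e f
  exact ⟨c, fun _ _ hw => hc _ (isTwoFactor_edges hw)⟩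
end
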